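/- For i = 1,…,K let H_{i,j} (j = 1,…,K) be M×M complex matrices, Q_j be M×n_j complex matrices, and let each transmitter i have a finite set of codewords x_i^{[1]}, …, x_i^{[P_i]} ∈ ℂ^{n_i}. For σ² > 0 define d_i^{[jk]}(σ²) = (x_i^{[j]} − x_i^{[k]})ᴴQ_iᴴH_{i,i}ᴴ(R̃_i + σ²·I)⁻¹H_{i,i}Q_i(x_i^{[j]} − x_i^{[k]}) with R̃_i = Σ_{l≠i} H_{i,l}Q_l(H_{i,l}Q_l)ᴴ, and define C(σ²) = Σᵢ Σⱼ log₂(Σₖ exp(−d_i^{[jk]}(σ²))). If at least one vector H_{i,i}Q_i(x_i^{[j]} − x_i^{[k]}) is nonzero, then C is strictly increasing on (0, ∞); equivalently, the finite-alphabet mutual-information objective Σᵢ f_MI({d_i}) = −C is strictly decreasing in the noise variance σ². -/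

import Mathlib

open Matrix

/-- The distance measure `d_i^{[jk]}(σ²)` between codewords `x_i^{[j]}` and `x_i^{[k]}`
at receiver `i` (equations (3)–(4) of the FIA paper). -/
noncomputable def distIK {K M : ℕ} (n : Fin K → ℕ) (P : Fin K → ℕ)
    (H : Fin K → Fin K → Matrix (Fin M) (Fin M) ℂ)
    (Q : ∀ j, Matrix (Fin M) (Fin (n j)) ℂ)
    (x : ∀ i, Fin (P i) → Fin (n i) → ℂ)
    (i : Fin K) (j k : Fin (P i)) (s : ℝ) : ℂ :=
  star ((H i i * Q i) *ᵥ (x i j - x i k)) ⬝ᵥ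
    ((∑ l ∈ Finset.univ.erase i, (H i l * Q l) * (H i l * Q l)ᴴ + (s : ℂ) • 1)⁻¹ *ᵥ
      ((H i i * Q i) *ᵥ (x i j - x i k)))

/-- `C(σ²) = Σᵢ Σⱼ log₂ (Σₖ exp(−d_i^{[jk]}(σ²)))`, the negated finite-alphabet
mutual-information objective, as a function of the noise variance. -/
noncomputable def objC {K M : ℕ} (n : Fin K → ℕ) (P : Fin K → ℕ)
    (H : Fin K → Fin K → Matrix (Fin M) (Fin M) ℂ)
    (Q : ∀ j, Matrix (Fin M) (Fin (n j)) ℂ)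
    (x : ∀ i, Fin (P i) → Fin (n i) → ℂ) (s : ℝ) : ℝ :=
  ∑ i : Fin K, ∑ j : Fin (P i),
    Real.logb 2 (∑ k : Fin (P i), Real.exp (-(distIK n P H Q x i j k s).re))

open scoped ComplexOrder in
/-- Matrix inversion is strictly antitone for the Loewner order on positive definite matrices. -/
theorem Matrix.PosDef.inv_sub_inv_add {m : Type*} [Fintype m] [DecidableEq m]
    {B C : Matrix m m ℂ} (hB : B.PosDef) (hC : C.PosDef) : (B⁻¹ - (B + C)⁻¹).PosDef := by
  have hT := hB.add hC
  have hBu : IsUnit B.det := (Matrix.isUnit_iff_isUnit_det B).1 hB.isUnit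
  have hTu : IsUnit (B + C).det := (Matrix.isUnit_iff_isUnit_det _).1 hT.isUnit
  have hCBC : (Cᴴ * B⁻¹ * C).PosSemidef := hB.inv.posSemidef.conjTranspose_mul_mul_same C
  rw [hC.isHermitian.eq] at hCBC
  have hinner : (B + C) * (B⁻¹ - (B + C)⁻¹) * (B + C) = C + C * B⁻¹ * C := by
    rw [mul_sub, sub_mul, mul_nonsing_inv _ hTu, one_mul, add_mul, mul_nonsing_inv _ hBu,
      add_mul, one_mul, mul_add, nonsing_inv_mul_cancel_right _ _ hBu]
    abel
  have hcongr : B⁻¹ - (B + C)⁻¹ = ((B + C)⁻¹)ᴴ * (C + C * B⁻¹ * C) * (B + C)⁻¹ := by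
    rw [hT.inv.isHermitian.eq, ← hinner, ← mul_assoc, ← mul_assoc, nonsing_inv_mul _ hTu, one_mul,
      mul_nonsing_inv_cancel_right _ _ hTu]
  rw [hcongr]
  exact (hC.add_posSemidef hCBC).conjTranspose_mul_mul_same
    (Matrix.mulVec_injective_of_isUnit hT.inv.isUnit)

open scoped ComplexOrder in
/-- The quadratic form of the resolvent of a positive semidefinite matrix is strictly decreasing
in the regularization parameter. -/
theorem re_dotProduct_inv_add_smul_one_lt {m : Type*} [Fintype m] [DecidableEq m]
    {A : Matrix m m ℂ} (hA : A.PosSemidef) {s t : ℝ} (hs : 0 < s) (hst : s < t)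
    {v : m → ℂ} (hv : v ≠ 0) :
    (star v ⬝ᵥ ((A + (t : ℂ) • 1)⁻¹ *ᵥ v)).re < (star v ⬝ᵥ ((A + (s : ℂ) • 1)⁻¹ *ᵥ v)).re := by
  have hpos {c : ℝ} (hc : 0 < c) : ((c : ℂ) • (1 : Matrix m m ℂ)).PosDef :=
    PosDef.one.smul (Complex.zero_lt_real.2 hc)
  have hdiff := (PosDef.posSemidef_add hA (hpos hs)).inv_sub_inv_add (hpos (sub_pos.2 hst))
  have hshift : A + (s : ℂ) • 1 + ((t - s : ℝ) : ℂ) • 1 = A + (t : ℂ) • 1 := by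
    rw [add_assoc, ← add_smul]
    simp
  rw [hshift] at hdiff
  have hquad := hdiff.re_dotProduct_pos hv
  rw [sub_mulVec, dotProduct_sub, map_sub] at hquad
  exact sub_pos.1 hquad

open scoped ComplexOrder in
theorem distIK_re_lt {K M : ℕ} (n : Fin K → ℕ) (P : Fin K → ℕ)
    (H : Fin K → Fin K → Matrix (Fin M) (Fin M) ℂ)
    (Q : ∀ j, Matrix (Fin M) (Fin (n j)) ℂ)
    (x : ∀ i, Fin (P i) → Fin (n i) → ℂ) {i : Fin K} {j k : Fin (P i)}
    (hv : (H i i * Q i) *ᵥ (x i j - x i k) ≠ 0) {s t : ℝ} (hs : 0 < s) (hst : s < t) :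
    (distIK n P H Q x i j k t).re < (distIK n P H Q x i j k s).re :=
  re_dotProduct_inv_add_smul_one_lt
    (posSemidef_sum _ fun l _ => posSemidef_self_mul_conjTranspose (H i l * Q l)) hs hst hv

theorem distIK_re_le {K M : ℕ} (n : Fin K → ℕ) (P : Fin K → ℕ)
    (H : Fin K → Fin K → Matrix (Fin M) (Fin M) ℂ)
    (Q : ∀ j, Matrix (Fin M) (Fin (n j)) ℂ)
    (x : ∀ i, Fin (P i) → Fin (n i) → ℂ) (i : Fin K) (j k : Fin (P i))
    {s t : ℝ} (hs : 0 < s) (hst : s < t) :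
    (distIK n P H Q x i j k t).re ≤ (distIK n P H Q x i j k s).re := by
  by_cases hv : (H i i * Q i) *ᵥ (x i j - x i k) = 0
  · simp [distIK, hv]
  · exact (distIK_re_lt n P H Q x hv hs hst).le

/-- Appendix C of the FIA paper: if at least one received error vector
`H_{i,i}Q_i(x_i^{[j]} − x_i^{[k]})` is nonzero, then `C` is strictly increasing in the
noise variance on `(0, ∞)`; equivalently the mutual-information objective `−C` is
strictly decreasing in `σ²`. -/
theorem objC_strictMonoOn {K M : ℕ} (n : Fin K → ℕ) (P : Fin K → ℕ)
    (H : Fin K → Fin K → Matrix (Fin M) (Fin M) ℂ)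
    (Q : ∀ j, Matrix (Fin M) (Fin (n j)) ℂ)
    (x : ∀ i, Fin (P i) → Fin (n i) → ℂ)
    (hne : ∃ (i : Fin K) (j k : Fin (P i)), (H i i * Q i) *ᵥ (x i j - x i k) ≠ 0) :
    StrictMonoOn (objC n P H Q x) (Set.Ioi (0 : ℝ)) := by
  obtain ⟨i₀, j₀, k₀, hv⟩ := hne
  intro s hs t _ hst
  have hexp (i : Fin K) (j k : Fin (P i)) : Real.exp (-(distIK n P H Q x i j k s).re) ≤
      Real.exp (-(distIK n P H Q x i j k t).re) :=
    Real.exp_le_exp.2 (neg_le_neg (distIK_re_le n P H Q x i j k hs hst))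
  have hpos (i : Fin K) (j : Fin (P i)) :
      0 < ∑ k : Fin (P i), Real.exp (-(distIK n P H Q x i j k s).re) :=
    Finset.sum_pos (fun _ _ => Real.exp_pos _) ⟨j, Finset.mem_univ j⟩
  have hlog (i : Fin K) (j : Fin (P i)) :
      Real.logb 2 (∑ k : Fin (P i), Real.exp (-(distIK n P H Q x i j k s).re)) ≤
        Real.logb 2 (∑ k : Fin (P i), Real.exp (-(distIK n P H Q x i j k t).re)) :=
    Real.logb_le_logb_of_le one_lt_two (hpos i j) (Finset.sum_le_sum fun k _ => hexp i j k)
  refine Finset.sum_lt_sum (fun i _ => Finset.sum_le_sum fun j _ => hlog i j)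
    ⟨i₀, Finset.mem_univ _, Finset.sum_lt_sum (fun j _ => hlog i₀ j)
      ⟨j₀, Finset.mem_univ _, Real.logb_lt_logb one_lt_two (hpos i₀ j₀) ?_⟩⟩
  exact Finset.sum_lt_sum (fun k _ => hexp i₀ j₀ k) ⟨k₀, Finset.mem_univ _,
    Real.exp_lt_exp.2 (neg_lt_neg (distIK_re_lt n P H Q x hv hs hst))⟩
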